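/- arXiv:1712.10119 — 11 statements merged into one kernel-verified Lean document; each statement's English description precedes it below -/
import Mathlib

section
/- Let X be a real Banach space, p ≥ 1 an integer, and T : X ⇉ X* a p-monotone multivalued operator. Let C = co(dom(T)) be the convex hull of the domain of T and let N_C be the normal cone operator of C. Then the operator T + N_C, defined by (T + N_C)(x) = {x* + y* : x* ∈ T(x), y* ∈ N_C(x)}, satisfies T + N_C ⊂ T^{μ_p}. -/
open scoped BigOperators

noncomputable section

variable {X : Type*} [NormedAddCommGroup X] [NormedSpace ℝ X]

/-- The cyclic sum `∑_{i=0}^{p} ⟨x_{i+1} − x_i, x_i*⟩` (indices mod `p+1`). -/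
def cyclicSum (p : ℕ) (a : Fin (p + 1) → X × (X →L[ℝ] ℝ)) : ℝ :=
  ∑ i : Fin (p + 1), (a i).2 ((a (i + 1)).1 - (a i).1)

/-- `T` is `p`-monotone. -/
def IsPMonotone (p : ℕ) (T : Set (X × (X →L[ℝ] ℝ))) : Prop :=
  ∀ a : Fin (p + 1) → X × (X →L[ℝ] ℝ), (∀ i, a i ∈ T) → cyclicSum p a ≤ 0

/-- The `p`-monotone polar `T^{μ_p}`. -/
def pPolar (p : ℕ) (T : Set (X × (X →L[ℝ] ℝ))) : Set (X × (X →L[ℝ] ℝ)) :=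
  {z | ∀ a : Fin (p + 1) → X × (X →L[ℝ] ℝ),
    a 0 = z → (∀ i, i ≠ 0 → a i ∈ T) → cyclicSum p a ≤ 0}

/-- `T` is maximal `p`-monotone. -/
def IsMaxPMonotone (p : ℕ) (T : Set (X × (X →L[ℝ] ℝ))) : Prop :=
  IsPMonotone p T ∧
    ∀ S : Set (X × (X →L[ℝ] ℝ)), IsPMonotone p S → T ⊆ S → S = T

/-- The domain of a multivalued operator. -/
def opDom (T : Set (X × (X →L[ℝ] ℝ))) : Set X := {x | ∃ xs, (x, xs) ∈ T}

/-- `T` is pre-maximal `p`-monotone: `T` and `T^{μ_p}` are `p`-monotone. -/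
def IsPreMaxPMonotone (p : ℕ) (T : Set (X × (X →L[ℝ] ℝ))) : Prop :=
  IsPMonotone p T ∧ IsPMonotone p (pPolar p T)

/-- The normal cone operator of a set `C ⊆ X`. -/
def normalCone (C : Set X) : Set (X × (X →L[ℝ] ℝ)) :=
  {z | z.1 ∈ C ∧ ∀ y ∈ C, z.2 (y - z.1) ≤ 0}

/-- The monotone polar `T^{μ}`. -/
def monoPolar (T : Set (X × (X →L[ℝ] ℝ))) : Set (X × (X →L[ℝ] ℝ)) :=
  {z | ∀ w ∈ T, 0 ≤ (z.2 - w.2) (z.1 - w.1)}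

/-- `T` is a monotone operator. -/
def IsMonotoneOp (T : Set (X × (X →L[ℝ] ℝ))) : Prop :=
  ∀ a ∈ T, ∀ b ∈ T, 0 ≤ (a.2 - b.2) (a.1 - b.1)

/-- The operator `T_{p+} : X^{p+1} ⇉ (X*)^{p+1}`. -/
def TpPlus (p : ℕ) (T : Set (X × (X →L[ℝ] ℝ))) :
    Set ((Fin (p + 1) → X) × (Fin (p + 1) → (X →L[ℝ] ℝ))) :=
  {z | ∀ i, ∃ u v, (z.1 i, u) ∈ T ∧ (z.1 (i + 1), v) ∈ T ∧ z.2 i = u - v}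

/-- The operator `T_{p−} : X^{p+1} ⇉ (X*)^{p+1}`. -/
def TpMinus (p : ℕ) (T : Set (X × (X →L[ℝ] ℝ))) :
    Set ((Fin (p + 1) → X) × (Fin (p + 1) → (X →L[ℝ] ℝ))) :=
  {z | ∀ i, ∃ u v, (z.1 i, u) ∈ T ∧ (z.1 (i - 1), v) ∈ T ∧ z.2 i = u - v}

/-- Monotonicity for operators `X^{p+1} ⇉ (X*)^{p+1}` with the product duality pairing. -/
def IsMonotoneBig (p : ℕ)
    (S : Set ((Fin (p + 1) → X) × (Fin (p + 1) → (X →L[ℝ] ℝ)))) : Prop :=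
  ∀ a ∈ S, ∀ b ∈ S, 0 ≤ ∑ i : Fin (p + 1), (a.2 i - b.2 i) (a.1 i - b.1 i)

/-- Maximal monotonicity for operators `X^{p+1} ⇉ (X*)^{p+1}`. -/
def IsMaxMonotoneBig (p : ℕ)
    (S : Set ((Fin (p + 1) → X) × (Fin (p + 1) → (X →L[ℝ] ℝ)))) : Prop :=
  IsMonotoneBig p S ∧
    ∀ S' : Set ((Fin (p + 1) → X) × (Fin (p + 1) → (X →L[ℝ] ℝ))),
      IsMonotoneBig p S' → S ⊆ S' → S' = S

/-- The adjoint operator `T*`: `(x,x*) ∈ T*` iff `⟨x,y*⟩ = ⟨y,x*⟩` for all `(y,y*) ∈ T`. -/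
def adjointOp (T : Set (X × (X →L[ℝ] ℝ))) : Set (X × (X →L[ℝ] ℝ)) :=
  {z | ∀ w ∈ T, w.2 z.1 = z.2 w.1}

/-- The adjoint of an operator `X^{p+1} ⇉ (X*)^{p+1}` w.r.t. the product duality pairing. -/
def adjointBig (p : ℕ)
    (S : Set ((Fin (p + 1) → X) × (Fin (p + 1) → (X →L[ℝ] ℝ)))) :
    Set ((Fin (p + 1) → X) × (Fin (p + 1) → (X →L[ℝ] ℝ))) :=
  {z | ∀ w ∈ S, ∑ i : Fin (p + 1), (w.2 i) (z.1 i) = ∑ i : Fin (p + 1), (z.2 i) (w.1 i)}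

/-- If `T` is `p`-monotone and `C = co(dom T)`, then `T + N_C ⊆ T^{μ_p}`. -/
theorem sum_normalCone_subset_pPolar [CompleteSpace X] (p : ℕ) (hp : 1 ≤ p)
    (T : Set (X × (X →L[ℝ] ℝ))) (hT : IsPMonotone p T) :
    {z : X × (X →L[ℝ] ℝ) | ∃ u v : X →L[ℝ] ℝ, (z.1, u) ∈ T ∧
      (z.1, v) ∈ normalCone (convexHull ℝ (opDom T)) ∧ z.2 = u + v} ⊆ pPolar p T := by
  rintro ⟨x, xs⟩ ⟨u, v, hu, hv, hxs⟩ a ha0 haT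
  dsimp only at hu hv hxs
  set b := Function.update a 0 (x, u) with hb
  have hbT : ∀ i, b i ∈ T := by
    intro i
    by_cases hi : i = 0
    · subst hi
      simpa [hb] using hu
    · simpa [hb, hi] using haT i hi
  have hb_fst : ∀ i, (b i).1 = (a i).1 := by
    intro i
    by_cases hi : i = 0
    · subst hi
      simp [hb, ha0]
    · simp [hb, hi]
  have hsum : cyclicSum p a = cyclicSum p b + v ((b (0 + 1)).1 - x) := by
    unfold cyclicSum
    simp only [hb_fst]
    rw [Fin.sum_univ_succ, Fin.sum_univ_succ]
    simp only [hb, Function.update_self, ne_eq, Fin.succ_ne_zero, not_false_eq_true,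
      Function.update_of_ne, ha0, hxs, add_apply]
    ring
  have hv_le : v ((b (0 + 1)).1 - x) ≤ 0 :=
    hv.2 _ (subset_convexHull ℝ _ ⟨_, hbT (0 + 1)⟩)
  linarith [hT b hbT]
end
end

section
/- Let X be a real Banach space, p ≥ 1 an integer, and T : X ⇉ X* a p-monotone multivalued operator. Then the double p-monotone polar T^{μ_p μ_p} = (T^{μ_p})^{μ_p} is contained in every maximal p-monotone operator S with T ⊂ S; in particular, T^{μ_p μ_p} is itself p-monotone. -/
open scoped BigOperators

noncomputable section

variable {X : Type*} [NormedAddCommGroup X] [NormedSpace ℝ X]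

/-- The sum of `⟨y - x, x*⟩` over consecutive points `(x, x*)`, `(y, y*)` of the walk from `u`
through the points of a list to `w`. -/
def walkSum : X × (X →L[ℝ] ℝ) → List (X × (X →L[ℝ] ℝ)) → X × (X →L[ℝ] ℝ) → ℝ
  | u, [], w => u.2 (w.1 - u.1)
  | u, v :: l, w => u.2 (v.1 - u.1) + walkSum v l w

theorem walkSum_append_cons (u v w : X × (X →L[ℝ] ℝ)) (l₁ l₂ : List (X × (X →L[ℝ] ℝ))) :
    walkSum u (l₁ ++ v :: l₂) w = walkSum u l₁ v + walkSum v l₂ w := by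
  induction l₁ generalizing u with
  | nil => simp [walkSum]
  | cons x l ih => simp only [List.cons_append, walkSum, ih, add_assoc]

theorem walkSum_replicate_append (u s w : X × (X →L[ℝ] ℝ)) (l : List (X × (X →L[ℝ] ℝ)))
    (k : ℕ) : walkSum u (List.replicate k s ++ s :: l) w = walkSum u (s :: l) w := by
  induction k with
  | zero => simp
  | succ k ih =>
    rw [List.replicate_succ, List.cons_append, ← ih]
    cases k <;> simp [walkSum, List.replicate_succ]

theorem walkSum_ofFn (n : ℕ) (a : Fin (n + 1) → X × (X →L[ℝ] ℝ)) (w : X × (X →L[ℝ] ℝ)) :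
    walkSum (a 0) (List.ofFn fun i : Fin n => a i.succ) w =
      ∑ i : Fin n, (a i.castSucc).2 ((a i.succ).1 - (a i.castSucc).1) +
        (a (Fin.last n)).2 (w.1 - (a (Fin.last n)).1) := by
  induction n with
  | zero => simp [walkSum]
  | succ n ih =>
    rw [List.ofFn_succ, walkSum, ih fun i => a i.succ, Fin.sum_univ_succ, ← add_assoc]
    rfl

theorem cyclicSum_eq_walkSum (p : ℕ) (a : Fin (p + 1) → X × (X →L[ℝ] ℝ)) :
    cyclicSum p a = walkSum (a 0) (List.ofFn fun i : Fin p => a i.succ) (a 0) := by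
  rw [walkSum_ofFn, cyclicSum, Fin.sum_univ_castSucc]
  simp

theorem cyclicSum_comp_add_right (p : ℕ) (a : Fin (p + 1) → X × (X →L[ℝ] ℝ))
    (j : Fin (p + 1)) : cyclicSum p (fun i => a (i + j)) = cyclicSum p a := by
  unfold cyclicSum
  simp only [add_right_comm _ (1 : Fin (p + 1)) j]
  exact Equiv.sum_comp (Equiv.addRight j) fun i => (a i).2 ((a (i + 1)).1 - (a i).1)

theorem pPolar_anti (p : ℕ) {S T : Set (X × (X →L[ℝ] ℝ))} (h : S ⊆ T) :
    pPolar p T ⊆ pPolar p S :=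
  fun _ hz a h0 ha => hz a h0 fun i hi => h (ha i hi)

theorem IsPMonotone.subset_pPolar {p : ℕ} {S : Set (X × (X →L[ℝ] ℝ))} (hS : IsPMonotone p S) :
    S ⊆ pPolar p S := by
  intro z hz a h0 ha
  refine hS a fun i => ?_
  by_cases hi : i = 0
  · rwa [hi, h0]
  · exact ha i hi

theorem walkSum_nonpos_of_mem_pPolar {p : ℕ} {S : Set (X × (X →L[ℝ] ℝ))}
    {z : X × (X →L[ℝ] ℝ)} (hz : z ∈ pPolar p S) (l : List (X × (X →L[ℝ] ℝ)))
    (hl : l.length ≤ p) (h : ∀ x ∈ l, x ∈ S) : walkSum z l z ≤ 0 := by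
  cases l with
  | nil => simp [walkSum]
  | cons s l =>
    rw [← walkSum_replicate_append z s z l (p - (s :: l).length)]
    have hm : ∀ x ∈ List.replicate (p - (s :: l).length) s ++ s :: l, x ∈ S := by
      intro x hx
      rcases List.mem_append.1 hx with hx | hx
      · rw [List.eq_of_mem_replicate hx]
        exact h s List.mem_cons_self
      · exact h x hx
    have hlen : (List.replicate (p - (s :: l).length) s ++ s :: l).length = p := by
      rw [List.length_append, List.length_replicate, Nat.sub_add_cancel hl]
    generalize List.replicate (p - (s :: l).length) s ++ s :: l = m at hm hlen
    subst hlen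
    have := hz (Fin.cons z m.get) rfl fun i hi => by
      obtain ⟨j, rfl⟩ := Fin.exists_succ_eq.2 hi
      exact hm _ (List.get_mem m j)
    rw [cyclicSum_eq_walkSum] at this
    simpa using this

theorem walkSum_nonpos_of_mem_insert {p : ℕ} {S : Set (X × (X →L[ℝ] ℝ))}
    {z : X × (X →L[ℝ] ℝ)} (hz : z ∈ pPolar p S) (l : List (X × (X →L[ℝ] ℝ)))
    (hl : l.length ≤ p) (h : ∀ x ∈ l, x ∈ insert z S) : walkSum z l z ≤ 0 := by
  by_cases hzl : z ∈ l
  · obtain ⟨l₁, l₂, hsplit⟩ := List.append_of_mem hzl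
    have hlen : l.length = l₁.length + (l₂.length + 1) := by simp [hsplit]
    rw [hsplit, walkSum_append_cons]
    exact add_nonpos
      (walkSum_nonpos_of_mem_insert hz l₁ (by omega) fun x hx => h x (by simp [hsplit, hx]))
      (walkSum_nonpos_of_mem_insert hz l₂ (by omega) fun x hx => h x (by simp [hsplit, hx]))
  · refine walkSum_nonpos_of_mem_pPolar hz l hl fun x hx => (h x hx).resolve_left ?_
    rintro rfl
    exact hzl hx
termination_by l.length
decreasing_by all_goals omega

theorem IsPMonotone.insert {p : ℕ} {S : Set (X × (X →L[ℝ] ℝ))} (hS : IsPMonotone p S)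
    {z : X × (X →L[ℝ] ℝ)} (hz : z ∈ pPolar p S) : IsPMonotone p (insert z S) := by
  intro a ha
  by_cases hj : ∃ j, a j = z
  · obtain ⟨j, rfl⟩ := hj
    rw [← cyclicSum_comp_add_right p a j, cyclicSum_eq_walkSum]
    simp only [zero_add]
    refine walkSum_nonpos_of_mem_insert hz _ (by simp) fun x hx => ?_
    obtain ⟨i, rfl⟩ := List.mem_ofFn.1 hx
    exact ha _
  · exact hS a fun i => (ha i).resolve_left fun h => hj ⟨i, h⟩

theorem IsMaxPMonotone.pPolar_subset {p : ℕ} {S : Set (X × (X →L[ℝ] ℝ))}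
    (hS : IsMaxPMonotone p S) : pPolar p S ⊆ S := fun z hz => by
  have h := hS.2 _ (hS.1.insert hz) (Set.subset_insert z S)
  exact h ▸ Set.mem_insert z S

theorem IsPMonotone.mono {p : ℕ} {S T : Set (X × (X →L[ℝ] ℝ))} (hT : IsPMonotone p T)
    (h : S ⊆ T) : IsPMonotone p S :=
  fun a ha => hT a fun i => h (ha i)

theorem IsPMonotone.sUnion_of_isChain {p : ℕ} {c : Set (Set (X × (X →L[ℝ] ℝ)))}
    (hc : IsChain (· ⊆ ·) c) (hne : c.Nonempty) (h : ∀ S ∈ c, IsPMonotone p S) :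
    IsPMonotone p (⋃₀ c) := by
  intro a ha
  obtain ⟨S, hS, haS⟩ := hc.directedOn.exists_mem_subset_of_finite_of_subset_sUnion hne
    (Set.finite_range a) (Set.range_subset_iff.2 ha)
  exact h S hS a fun i => haS ⟨i, rfl⟩

theorem IsPMonotone.exists_isMaxPMonotone {p : ℕ} {T : Set (X × (X →L[ℝ] ℝ))}
    (hT : IsPMonotone p T) : ∃ S, T ⊆ S ∧ IsMaxPMonotone p S := by
  obtain ⟨S, hTS, hS⟩ := zorn_subset_nonempty {S | IsPMonotone p S}
    (fun c hc hchain hne => ⟨⋃₀ c, IsPMonotone.sUnion_of_isChain hchain hne fun _ h => hc h,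
      fun _ => Set.subset_sUnion_of_mem⟩) T hT
  exact ⟨S, hTS, hS.prop, fun R hR hSR => (hS.eq_of_subset hR hSR).symm⟩

/-- `T^{μ_p μ_p}` is contained in every maximal `p`-monotone extension of `T`;
in particular it is `p`-monotone. -/
theorem double_pPolar_subset_maximal_extensions [CompleteSpace X] (p : ℕ) (hp : 1 ≤ p)
    (T : Set (X × (X →L[ℝ] ℝ))) (hT : IsPMonotone p T) :
    (∀ S : Set (X × (X →L[ℝ] ℝ)), IsMaxPMonotone p S → T ⊆ S →
      pPolar p (pPolar p T) ⊆ S) ∧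
    IsPMonotone p (pPolar p (pPolar p T)) := by
  have key : ∀ S : Set (X × (X →L[ℝ] ℝ)), IsMaxPMonotone p S → T ⊆ S →
      pPolar p (pPolar p T) ⊆ S := fun S hS hTS =>
    (pPolar_anti p (hS.1.subset_pPolar.trans (pPolar_anti p hTS))).trans hS.pPolar_subset
  obtain ⟨S, hTS, hS⟩ := hT.exists_isMaxPMonotone
  exact ⟨key, hS.1.mono (key S hS hTS)⟩
end
end

section
/- Let X be a real Banach space, p ≥ 1 an integer, and T, S : X ⇉ X* multivalued operators. If T is pre-maximal p-monotone and T ⊂ S ⊂ T^{μ_p}, then S is pre-maximal p-monotone and S^{μ_p} = T^{μ_p}. -/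
open scoped BigOperators

noncomputable section

variable {X : Type*} [NormedAddCommGroup X] [NormedSpace ℝ X]

/-- If `T` is pre-maximal `p`-monotone and `T ⊆ S ⊆ T^{μ_p}`, then `S` is
pre-maximal `p`-monotone and `S^{μ_p} = T^{μ_p}`. -/
theorem preMax_of_between [CompleteSpace X] (p : ℕ) (hp : 1 ≤ p)
    (T S : Set (X × (X →L[ℝ] ℝ))) (hT : IsPreMaxPMonotone p T)
    (hTS : T ⊆ S) (hSpol : S ⊆ pPolar p T) :
    IsPreMaxPMonotone p S ∧ pPolar p S = pPolar p T := by
  have hpol := hT.2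
  have hS : pPolar p S = pPolar p T := by
    refine Set.Subset.antisymm
      (fun z hz a ha0 ha => hz a ha0 fun i hi => hTS (ha i hi))
      (fun z hz a ha0 ha => hpol a fun i => ?_)
    by_cases hi : i = 0
    · rwa [hi, ha0]
    · exact hSpol (ha i hi)
  exact ⟨⟨fun a ha => hpol a fun i => hSpol (ha i), hS ▸ hpol⟩, hS⟩
end
end

section
/- Let X be a real Banach space, p ≥ 1 an integer, and T : X ⇉ X* a p-monotone multivalued operator whose graph is convex and contains (0,0). Then the operator T_cone whose graph is the conic hull cone(graph(T)) = {t·(x,x*) : t ≥ 0, (x,x*) ∈ graph(T)} is p-monotone, and moreover −cone(graph(T)) ⊂ graph(T^{μ_p}). -/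
open scoped BigOperators

noncomputable section

variable {X : Type*} [NormedAddCommGroup X] [NormedSpace ℝ X]

theorem cyclicSum_smul (p : ℕ) (c : ℝ) (a : Fin (p + 1) → X × (X →L[ℝ] ℝ)) :
    cyclicSum p (fun i => c • a i) = c ^ 2 * cyclicSum p a := by
  simp only [cyclicSum, Finset.mul_sum]
  refine Finset.sum_congr rfl fun i _ => ?_
  simp only [Prod.smul_snd, Prod.smul_fst, ← smul_sub, smul_apply, map_smul,
    smul_eq_mul]
  ring

theorem cyclicSum_add_const (p : ℕ) (z : X × (X →L[ℝ] ℝ))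
    (a : Fin (p + 1) → X × (X →L[ℝ] ℝ)) :
    cyclicSum p (fun i => a i + z) = cyclicSum p a := by
  have telescope : ∑ i : Fin (p + 1), ((a (i + 1)).1 - (a i).1) = 0 := by
    rw [Finset.sum_sub_distrib, sub_eq_zero]
    exact Equiv.sum_comp (Equiv.addRight (1 : Fin (p + 1))) fun i => (a i).1
  simp only [cyclicSum, Prod.fst_add, Prod.snd_add, add_sub_add_right_eq_sub,
    add_apply, Finset.sum_add_distrib]
  rw [← map_sum, telescope, map_zero, add_zero]

/-- The conic hull of a set in a real vector space. -/
def conicHull {E : Type*} [AddCommGroup E] [Module ℝ E] (S : Set E) : Set E :=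
  {z | ∃ t : ℝ, 0 ≤ t ∧ ∃ w ∈ S, z = t • w}

theorem subset_conicHull {E : Type*} [AddCommGroup E] [Module ℝ E] (S : Set E) :
    S ⊆ conicHull S :=
  fun w hw => ⟨1, zero_le_one, w, hw, (one_smul ℝ w).symm⟩

theorem Convex.add_mem_conicHull {E : Type*} [AddCommGroup E] [Module ℝ E] {S : Set E}
    (hS : Convex ℝ S) {x y : E} (hx : x ∈ conicHull S) (hy : y ∈ conicHull S) :
    x + y ∈ conicHull S := by
  obtain ⟨t, ht, w, hw, rfl⟩ := hx
  obtain ⟨s, hs, v, hv, rfl⟩ := hy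
  rcases (add_nonneg ht hs).eq_or_lt with h | h
  · obtain rfl : t = 0 := by linarith
    obtain rfl : s = 0 := by linarith
    exact ⟨0, le_rfl, w, hw, by simp⟩
  · refine ⟨t + s, h.le, (t / (t + s)) • w + (s / (t + s)) • v,
      hS hw hv (by positivity) (by positivity) (by field_simp), ?_⟩
    rw [smul_add, smul_smul, smul_smul, mul_div_cancel₀ _ h.ne', mul_div_cancel₀ _ h.ne']

theorem Convex.exists_pos_smul_mem_of_mem_conicHull {E ι : Type*} [Fintype ι] [AddCommGroup E]
    [Module ℝ E] {S : Set E} (hS : Convex ℝ S) (h0 : (0 : E) ∈ S) {a : ι → E}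
    (ha : ∀ i, a i ∈ conicHull S) : ∃ c : ℝ, 0 < c ∧ ∀ i, c • a i ∈ S := by
  choose t ht w hw hz using ha
  have hsum : 0 ≤ ∑ i, t i := Finset.sum_nonneg fun i _ => ht i
  refine ⟨(1 + ∑ i, t i)⁻¹, by positivity, fun i => ?_⟩
  rw [hz i, smul_smul]
  have hle : t i ≤ ∑ j, t j := Finset.single_le_sum (fun j _ => ht j) (Finset.mem_univ i)
  refine hS.smul_mem_of_zero_mem h0 (hw i) ⟨mul_nonneg (by positivity) (ht i), ?_⟩
  rw [inv_mul_le_one₀ (by positivity)]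
  linarith

theorem IsPMonotone.conicHull {p : ℕ} {T : Set (X × (X →L[ℝ] ℝ))} (hT : IsPMonotone p T)
    (hconv : Convex ℝ T) (h0 : (0 : X × (X →L[ℝ] ℝ)) ∈ T) : IsPMonotone p (conicHull T) := by
  intro a ha
  obtain ⟨c, hc, hmem⟩ := hconv.exists_pos_smul_mem_of_mem_conicHull h0 ha
  have h := hT _ hmem
  rw [cyclicSum_smul] at h
  exact nonpos_of_mul_nonpos_right h (by positivity)

theorem IsPMonotone.neg_conicHull_subset_pPolar {p : ℕ} {T : Set (X × (X →L[ℝ] ℝ))}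
    (hT : IsPMonotone p T) (hconv : Convex ℝ T) (h0 : (0 : X × (X →L[ℝ] ℝ)) ∈ T) :
    -_root_.conicHull T ⊆ pPolar p T := by
  intro z hz a haz haT
  rw [← cyclicSum_add_const p (-z) a]
  refine hT.conicHull hconv h0 _ fun i => ?_
  by_cases hi : i = 0
  · rw [hi, haz, add_neg_cancel]
    exact subset_conicHull T h0
  · exact hconv.add_mem_conicHull (subset_conicHull T (haT i hi)) hz

/-- If `T` is `p`-monotone with convex graph containing `(0,0)`, then the operator
whose graph is `cone(graph T)` is `p`-monotone, and `−cone(graph T) ⊆ T^{μ_p}`. -/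
theorem coneHull_pMonotone_and_neg_subset_polar [CompleteSpace X] (p : ℕ) (hp : 1 ≤ p)
    (T : Set (X × (X →L[ℝ] ℝ))) (hT : IsPMonotone p T) (hconv : Convex ℝ T)
    (h0 : (0 : X × (X →L[ℝ] ℝ)) ∈ T) :
    IsPMonotone p {z : X × (X →L[ℝ] ℝ) | ∃ t : ℝ, 0 ≤ t ∧ ∃ w ∈ T, z = t • w} ∧
    -{z : X × (X →L[ℝ] ℝ) | ∃ t : ℝ, 0 ≤ t ∧ ∃ w ∈ T, z = t • w} ⊆ pPolar p T := by
  exact ⟨hT.conicHull hconv h0, hT.neg_conicHull_subset_pPolar hconv h0⟩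
end
end

section
/- Let X be a real Banach space, p ≥ 1 an integer, and T : X ⇉ X* a p-monotone multivalued operator whose graph is convex. Then the affine hull of the graph of T is contained in the graph of T^{μ_p}: aff(graph(T)) ⊂ graph(T^{μ_p}). -/
open scoped BigOperators

noncomputable section

variable {X : Type*} [NormedAddCommGroup X] [NormedSpace ℝ X]

theorem cyclicSum_lineMap (p : ℕ) (w : X × (X →L[ℝ] ℝ)) (s : ℝ)
    (a : Fin (p + 1) → X × (X →L[ℝ] ℝ)) :
    cyclicSum p (fun i => w + s • (a i - w)) = s ^ 2 * cyclicSum p a := by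
  have hcycle : ∑ i : Fin (p + 1), w.2 ((a (i + 1)).1 - (a i).1) = 0 := by
    simp only [map_sub, Finset.sum_sub_distrib]
    rw [sub_eq_zero]
    exact Equiv.sum_comp (Equiv.addRight (1 : Fin (p + 1))) (fun i => w.2 (a i).1)
  have hterm : ∀ i : Fin (p + 1),
      (w + s • (a i - w)).2 ((w + s • (a (i + 1) - w)).1 - (w + s • (a i - w)).1) =
        s ^ 2 * (a i).2 ((a (i + 1)).1 - (a i).1) +
          (s - s ^ 2) * w.2 ((a (i + 1)).1 - (a i).1) := by
    intro i
    simp only [Prod.fst_add, Prod.snd_add, Prod.smul_fst, Prod.smul_snd, Prod.fst_sub,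
      Prod.snd_sub, add_apply, smul_apply, sub_apply, map_sub, map_add,
      map_smul, smul_eq_mul]
    ring
  simp only [cyclicSum, hterm]
  rw [Finset.sum_add_distrib, ← Finset.mul_sum, ← Finset.mul_sum, hcycle, mul_zero, add_zero]

/-- The direction of the affine span of a nonempty convex set consists of the nonnegative
multiples of differences of its points. -/
theorem Convex.exists_smul_sub_of_mem_vectorSpan {E : Type*} [AddCommGroup E] [Module ℝ E]
    {T : Set E} (hconv : Convex ℝ T) (hne : T.Nonempty) {v : E} (hv : v ∈ vectorSpan ℝ T) :
    ∃ a ∈ T, ∃ b ∈ T, ∃ t : ℝ, 0 ≤ t ∧ v = t • (a - b) := by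
  rw [vectorSpan_def] at hv
  induction hv using Submodule.span_induction with
  | mem x hx =>
    obtain ⟨a, ha, b, hb, rfl⟩ := hx
    exact ⟨a, ha, b, hb, 1, zero_le_one, by simp⟩
  | zero =>
    obtain ⟨a, ha⟩ := hne
    exact ⟨a, ha, a, ha, 0, le_rfl, by simp⟩
  | add x y _ _ hx hy =>
    obtain ⟨a, ha, b, hb, t, ht, rfl⟩ := hx
    obtain ⟨a', ha', b', hb', r, hr, rfl⟩ := hy
    obtain ⟨A, hA, hAeq⟩ := hconv.exists_mem_add_smul_eq ha ha' ht hr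
    obtain ⟨B, hB, hBeq⟩ := hconv.exists_mem_add_smul_eq hb hb' ht hr
    refine ⟨A, hA, B, hB, t + r, add_nonneg ht hr, ?_⟩
    rw [smul_sub (t + r), hAeq, hBeq]
    module
  | smul c x _ hx =>
    obtain ⟨a, ha, b, hb, t, ht, rfl⟩ := hx
    rcases le_total 0 c with hc | hc
    · exact ⟨a, ha, b, hb, c * t, mul_nonneg hc ht, by module⟩
    · exact ⟨b, hb, a, ha, -c * t, mul_nonneg (neg_nonneg.2 hc) ht, by module⟩

theorem Convex.exists_add_smul_sub_mem_of_mem_affineSpan {E : Type*} [AddCommGroup E]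
    [Module ℝ E] {T : Set E} (hconv : Convex ℝ T) {z : E} (hz : z ∈ affineSpan ℝ T) :
    ∃ w ∈ T, ∃ s : ℝ, 0 < s ∧ s ≤ 1 ∧ w + s • (z - w) ∈ T := by
  obtain ⟨q, hq⟩ : T.Nonempty := (affineSpan_nonempty ℝ).1 ⟨z, hz⟩
  have hv : z - q ∈ vectorSpan ℝ T := by
    rw [← direction_affineSpan]
    exact AffineSubspace.vsub_mem_direction hz (subset_affineSpan ℝ T hq)
  obtain ⟨a, ha, b, hb, t, ht, hzq⟩ := hconv.exists_smul_sub_of_mem_vectorSpan ⟨q, hq⟩ hv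
  obtain ⟨A, hA, hAeq⟩ := hconv.exists_mem_add_smul_eq hq ha zero_le_one ht
  have hpos : 0 < 1 + t := by linarith
  refine ⟨b, hb, (1 + t)⁻¹, inv_pos.2 hpos, inv_le_one_of_one_le₀ (by linarith), ?_⟩
  have hzA : z - b = (1 + t) • (A - b) := by
    rw [smul_sub, hAeq, sub_eq_iff_eq_add.1 hzq]
    module
  rwa [hzA, inv_smul_smul₀ hpos.ne', add_sub_cancel]

/-- If `T` is `p`-monotone with convex graph, then `aff(graph T) ⊆ T^{μ_p}`. -/
theorem affineSpan_subset_pPolar [CompleteSpace X] (p : ℕ) (hp : 1 ≤ p)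
    (T : Set (X × (X →L[ℝ] ℝ))) (hT : IsPMonotone p T) (hconv : Convex ℝ T) :
    (affineSpan ℝ T : Set (X × (X →L[ℝ] ℝ))) ⊆ pPolar p T := by
  intro z hz a ha0 haT
  obtain ⟨w, hw, s, hs, hs1, hmem⟩ := hconv.exists_add_smul_sub_mem_of_mem_affineSpan hz
  have h := hT (fun i => w + s • (a i - w)) fun i => by
    by_cases hi : i = 0
    · simpa only [hi, ha0] using hmem
    · exact hconv.add_smul_sub_mem hw (haT i hi) ⟨hs.le, hs1⟩
  rw [cyclicSum_lineMap] at h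
  exact nonpos_of_mul_nonpos_right h (pow_pos hs 2)
end
end

section
/- Let X be a real Banach space, p ≥ 1 an integer, and T : X ⇉ X* a linear multivalued operator. The following are equivalent: (1) T is p-monotone; (2) T^{μ_p}(0) = dom(T)^⊥; (3) T^{μ_p} is nonempty; (4) (0,0) ∈ T^{μ_p}. -/
open scoped BigOperators

noncomputable section

variable {X : Type*} [NormedAddCommGroup X] [NormedSpace ℝ X]

theorem cyclicSum_add_smul (p : ℕ) (a b : Fin (p + 1) → X × (X →L[ℝ] ℝ)) (t : ℝ) :
    cyclicSum p (a + t • b) = cyclicSum p a +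
      t * (∑ i, ((a i).2 ((b (i + 1)).1 - (b i).1) + (b i).2 ((a (i + 1)).1 - (a i).1))) +
      t ^ 2 * cyclicSum p b := by
  simp only [cyclicSum, Finset.mul_sum, ← Finset.sum_add_distrib]
  refine Finset.sum_congr rfl fun i _ => ?_
  simp
  ring

theorem cyclicSum_sub_const (p : ℕ) (a : Fin (p + 1) → X × (X →L[ℝ] ℝ))
    (c : X × (X →L[ℝ] ℝ)) : cyclicSum p (fun i => a i - c) = cyclicSum p a := by
  have hshift : ∑ i, c.2 (a (i + 1)).1 = ∑ i, c.2 (a i).1 :=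
    Equiv.sum_comp (Equiv.addRight (1 : Fin (p + 1))) fun i => c.2 (a i).1
  simp only [cyclicSum, Prod.fst_sub, Prod.snd_sub, sub_sub_sub_cancel_right,
    sub_apply, Finset.sum_sub_distrib, map_sub, hshift]

theorem leadingCoeff_nonpos_of_quadratic_nonpos {A B C : ℝ}
    (h : ∀ t : ℝ, A + t * B + t ^ 2 * C ≤ 0) : C ≤ 0 := by
  by_contra! hC
  have h₁ := h (|A| / C + 1)
  have h₂ := h (-(|A| / C + 1))
  have hs : 0 ≤ |A| / C := by positivity
  have hsC : |A| / C * C = |A| := div_mul_cancel₀ _ hC.ne'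
  nlinarith [neg_abs_le A, mul_nonneg hs hC.le, mul_nonneg (mul_nonneg hs hs) hC.le]

theorem linearCoeff_eq_zero_of_quadratic_nonpos {B C : ℝ}
    (h : ∀ t : ℝ, t * B + t ^ 2 * C ≤ 0) : B = 0 := by
  have hC : C ≤ 0 :=
    leadingCoeff_nonpos_of_quadratic_nonpos (A := 0) (B := B) fun t => by simpa using h t
  have hD : 0 < 1 - C := by linarith
  have h₁ := h (B / (1 - C))
  have h₂ : B / (1 - C) * B + (B / (1 - C)) ^ 2 * C = (B / (1 - C)) ^ 2 := by
    field_simp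
    ring
  rw [h₂] at h₁
  have h₃ : B / (1 - C) = 0 := pow_eq_zero_iff two_ne_zero |>.mp (le_antisymm h₁ (sq_nonneg _))
  exact (div_eq_zero_iff.mp h₃).resolve_right hD.ne'

theorem single_add_smul_mem_of_ne_zero {p : ℕ} (L : Submodule ℝ (X × (X →L[ℝ] ℝ)))
    (z : X × (X →L[ℝ] ℝ)) {b : Fin (p + 1) → X × (X →L[ℝ] ℝ)}
    (hb : ∀ i, i ≠ 0 → b i ∈ L) (t : ℝ) (i : Fin (p + 1)) (hi : i ≠ 0) :
    (Pi.single 0 z + t • b : Fin (p + 1) → X × (X →L[ℝ] ℝ)) i ∈ L := by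
  simpa [hi] using L.smul_mem t (hb i hi)

theorem cyclicSum_single_add_smul_nonpos {p : ℕ} {L : Submodule ℝ (X × (X →L[ℝ] ℝ))}
    {z : X × (X →L[ℝ] ℝ)} (hz : z ∈ pPolar p (L : Set (X × (X →L[ℝ] ℝ))))
    {b : Fin (p + 1) → X × (X →L[ℝ] ℝ)} (hb₀ : b 0 = 0) (hb : ∀ i, i ≠ 0 → b i ∈ L) (t : ℝ) :
    cyclicSum p (Pi.single 0 z + t • b) ≤ 0 :=
  hz _ (by simp [hb₀]) (single_add_smul_mem_of_ne_zero L z hb t)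

theorem zero_mem_pPolar_of_nonempty {p : ℕ} {L : Submodule ℝ (X × (X →L[ℝ] ℝ))}
    (h : (pPolar p (L : Set (X × (X →L[ℝ] ℝ)))).Nonempty) :
    (0 : X × (X →L[ℝ] ℝ)) ∈ pPolar p (L : Set (X × (X →L[ℝ] ℝ))) := by
  obtain ⟨z, hz⟩ := h
  intro b hb₀ hb
  have hquad (t : ℝ) := cyclicSum_single_add_smul_nonpos hz hb₀ hb t
  simp only [cyclicSum_add_smul] at hquad
  exact leadingCoeff_nonpos_of_quadratic_nonpos hquad

theorem isPMonotone_of_zero_mem_pPolar {p : ℕ} {L : Submodule ℝ (X × (X →L[ℝ] ℝ))}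
    (h : (0 : X × (X →L[ℝ] ℝ)) ∈ pPolar p (L : Set (X × (X →L[ℝ] ℝ)))) :
    IsPMonotone p (L : Set (X × (X →L[ℝ] ℝ))) := by
  intro a ha
  rw [← cyclicSum_sub_const p a (a 0)]
  exact h _ (sub_self _) fun i _ => L.sub_mem (ha i) (ha 0)

theorem cyclicSum_single_zero_add_smul {p : ℕ} (xs : X →L[ℝ] ℝ)
    {b : Fin (p + 1) → X × (X →L[ℝ] ℝ)} (hb₀ : b 0 = 0) (t : ℝ) :
    cyclicSum p (Pi.single 0 ((0, xs) : X × (X →L[ℝ] ℝ)) + t • b) =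
      t * xs (b 1).1 + t ^ 2 * cyclicSum p b := by
  have hfst (i : Fin (p + 1)) :
      ((Pi.single 0 ((0, xs) : X × (X →L[ℝ] ℝ)) : Fin (p + 1) → X × (X →L[ℝ] ℝ)) i).1 = 0 := by
    by_cases hi : i = 0
    · subst hi; simp
    · simp [hi]
  rw [cyclicSum_add_smul]
  have hA : cyclicSum p (Pi.single 0 ((0, xs) : X × (X →L[ℝ] ℝ))) = 0 := by simp [cyclicSum, hfst]
  rw [hA, zero_add]
  congr 2
  rw [Finset.sum_eq_single 0]
  · simp [hfst, hb₀]
  · intro i _ hi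
    simp [hfst, hi]
  · simp

theorem pPolar_zero_eq_of_zero_mem {p : ℕ} (hp : 1 ≤ p) {L : Submodule ℝ (X × (X →L[ℝ] ℝ))}
    (h : (0 : X × (X →L[ℝ] ℝ)) ∈ pPolar p (L : Set (X × (X →L[ℝ] ℝ)))) :
    {xs : X →L[ℝ] ℝ | ((0 : X), xs) ∈ pPolar p (L : Set (X × (X →L[ℝ] ℝ)))} =
      {xs : X →L[ℝ] ℝ | ∀ x ∈ opDom (L : Set (X × (X →L[ℝ] ℝ))), xs x = 0} := by
  have h10 : (1 : Fin (p + 1)) ≠ 0 := by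
    have : NeZero p := ⟨by omega⟩
    simp
  ext xs
  constructor
  · rintro hxs x ⟨ys, hy⟩
    let b : Fin (p + 1) → X × (X →L[ℝ] ℝ) := fun i => if i = 0 then 0 else (x, ys)
    have hb₀ : b 0 = 0 := if_pos rfl
    have hb (i) (hi : i ≠ 0) : b i ∈ L := by simpa [b, hi] using hy
    have hb₁ : (b 1).1 = x := by simp only [b, if_neg h10]
    refine linearCoeff_eq_zero_of_quadratic_nonpos (C := cyclicSum p b) fun t => ?_
    rw [← hb₁, ← cyclicSum_single_zero_add_smul xs hb₀]
    exact cyclicSum_single_add_smul_nonpos hxs hb₀ hb t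
  · intro hxs a ha₀ ha
    let b : Fin (p + 1) → X × (X →L[ℝ] ℝ) := fun i => if i = 0 then 0 else a i
    have hb₀ : b 0 = 0 := if_pos rfl
    have hb (i) (hi : i ≠ 0) : b i ∈ L := by simpa [b, hi] using ha i hi
    have hab : a = Pi.single 0 ((0, xs) : X × (X →L[ℝ] ℝ)) + (1 : ℝ) • b := by
      funext i
      by_cases hi : i = 0
      · subst hi; simp [ha₀, hb₀]
      · simp [hi, b]
    rw [hab, cyclicSum_single_zero_add_smul xs hb₀, hxs (b 1).1 ⟨(b 1).2, hb 1 h10⟩]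
    simpa using h b hb₀ hb

/-- For a linear operator `T`, TFAE: (1) `T` is `p`-monotone;
(2) `T^{μ_p}(0) = dom(T)^⊥`; (3) `T^{μ_p} ≠ ∅`; (4) `(0,0) ∈ T^{μ_p}`. -/
theorem linear_pMonotone_tfae [CompleteSpace X] (p : ℕ) (hp : 1 ≤ p)
    (T : Set (X × (X →L[ℝ] ℝ)))
    (hlin : ∃ L : Submodule ℝ (X × (X →L[ℝ] ℝ)), T = ↑L) :
    [IsPMonotone p T,
     {xs : X →L[ℝ] ℝ | ((0 : X), xs) ∈ pPolar p T} =
       {xs : X →L[ℝ] ℝ | ∀ x ∈ opDom T, xs x = 0},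
     (pPolar p T).Nonempty,
     (0 : X × (X →L[ℝ] ℝ)) ∈ pPolar p T].TFAE := by
  obtain ⟨L, rfl⟩ := hlin
  tfae_have 1 → 4 := fun h a ha₀ ha => h a fun i => by
    by_cases hi : i = 0
    · rw [hi, ha₀]
      exact L.zero_mem
    · exact ha i hi
  tfae_have 4 → 3 := fun h => ⟨0, h⟩
  tfae_have 3 → 4 := zero_mem_pPolar_of_nonempty
  tfae_have 4 → 1 := isPMonotone_of_zero_mem_pPolar
  tfae_have 4 → 2 := pPolar_zero_eq_of_zero_mem hp
  tfae_have 2 → 4 := fun h => h.ge fun x _ => zero_apply x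
  tfae_finish
end
end

section
/- Let X be a real Banach space, p ≥ 1 an integer, and T : X ⇉ X* a linear multivalued operator. Then: (1) if T is maximal p-monotone, then T(0) = dom(T)^⊥; (2) if T is p-monotone, dom(T) is norm-closed, and T(0) = dom(T)^⊥, then T is maximal monotone and, in particular, maximal p-monotone. -/
open scoped BigOperators

noncomputable section

variable {X : Type*} [NormedAddCommGroup X] [NormedSpace ℝ X]

theorem cyclicSum_pair (p : ℕ) (hp : 1 ≤ p) (z w : X × (X →L[ℝ] ℝ)) :
    cyclicSum p (fun i => if i = 0 then z else w) = z.2 (w.1 - z.1) + w.2 (z.1 - w.1) := by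
  obtain ⟨q, rfl⟩ : ∃ q, p = q + 1 := ⟨p - 1, by omega⟩
  have h10 : (1 : Fin (q + 1 + 1)) ≠ 0 := by simp
  have key : ∀ i : Fin (q + 1 + 1),
      (if i = 0 then z else w).2 ((if i + 1 = 0 then z else w).1 - (if i = 0 then z else w).1) =
        (if i = 0 then z.2 (w.1 - z.1) else 0) + (if i = -1 then w.2 (z.1 - w.1) else 0) := by
    intro i
    simp only [← eq_neg_iff_add_eq_zero (a := i)]
    by_cases h0 : i = 0
    · subst h0
      have h : (0 : Fin (q + 1 + 1)) ≠ -1 := fun h => h10 (neg_eq_zero.mp h.symm)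
      simp [h]
    · by_cases h1 : i = -1 <;> simp [h0, h1]
  unfold cyclicSum
  simp only [key, Finset.sum_add_distrib, Finset.sum_ite_eq', Finset.mem_univ, if_true]

theorem IsPMonotone.isMonotoneOp {p : ℕ} (hp : 1 ≤ p) {T : Set (X × (X →L[ℝ] ℝ))}
    (h : IsPMonotone p T) : IsMonotoneOp T := by
  intro a ha b hb
  have h1 := h (fun i => if i = 0 then a else b) (fun i => by split_ifs <;> assumption)
  rw [cyclicSum_pair p hp] at h1
  simp only [map_sub, sub_apply] at h1 ⊢
  linarith

theorem IsMonotoneOp.isPMonotone_one {T : Set (X × (X →L[ℝ] ℝ))}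
    (h : IsMonotoneOp T) : IsPMonotone 1 T := by
  intro a ha
  have h1 := h _ (ha 0) _ (ha 1)
  have h2 : cyclicSum 1 a = (a 0).2 ((a 1).1 - (a 0).1) + (a 1).2 ((a 0).1 - (a 1).1) :=
    Fin.sum_univ_two _
  rw [h2]
  simp only [map_sub, sub_apply] at h1 ⊢
  linarith

theorem eq_zero_of_forall_add_mul_nonneg {a b : ℝ} (h : ∀ t : ℝ, 0 ≤ a + t * b) : b = 0 := by
  by_contra hb
  have h1 := h (-(a + 1) / b)
  rw [div_mul_cancel₀ _ hb] at h1
  linarith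

theorem eq_zero_of_forall_mul_add_sq_mul_nonneg {a b : ℝ}
    (h : ∀ t : ℝ, 0 ≤ t * b + t ^ 2 * a) : b = 0 := by
  have ha : 0 ≤ a := by linarith [h 1, h (-1)]
  have h1 := h (-b / (a + 1))
  have e : -b / (a + 1) * b + (-b / (a + 1)) ^ 2 * a = -(b / (a + 1)) ^ 2 := by
    field_simp
    ring
  rw [e] at h1
  have h2 : b / (a + 1) = 0 := by nlinarith [sq_nonneg (b / (a + 1))]
  rcases div_eq_zero_iff.mp h2 with h3 | h3
  · exact h3
  · linarith

theorem IsMonotoneOp.apply_eq_zero {L : Submodule ℝ (X × (X →L[ℝ] ℝ))}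
    (h : IsMonotoneOp (L : Set (X × (X →L[ℝ] ℝ)))) {u : X →L[ℝ] ℝ} (hu : ((0 : X), u) ∈ L)
    {x : X} (hx : x ∈ opDom (L : Set (X × (X →L[ℝ] ℝ)))) : u x = 0 := by
  obtain ⟨v, hv⟩ := hx
  refine eq_zero_of_forall_add_mul_nonneg (a := v x) fun t => ?_
  have h1 := h _ (L.add_mem hv (L.smul_mem t hu)) _ L.zero_mem
  simpa using h1

/-- Adding functionals that annihilate the domain preserves `p`-monotonicity. -/
theorem IsPMonotone.add_annihilator {p : ℕ} {T : Set (X × (X →L[ℝ] ℝ))} (h : IsPMonotone p T) :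
    IsPMonotone p {z | ∃ v u : X →L[ℝ] ℝ, (z.1, v) ∈ T ∧ (∀ x ∈ opDom T, u x = 0) ∧
      z.2 = v + u} := by
  intro a ha
  choose v u hv hu he using ha
  have h1 := h (fun i => ((a i).1, v i)) hv
  have h2 : cyclicSum p a = cyclicSum p (fun i => ((a i).1, v i)) := by
    refine Finset.sum_congr rfl fun i _ => ?_
    simp [he, hu i _ ⟨_, hv i⟩, hu i _ ⟨_, hv (i + 1)⟩]
  rwa [h2]

/-- A monotone extension of a linear operator `L` with closed domain and `L(0) = dom(L)^⊥`
is contained in `L`. -/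
theorem IsMonotoneOp.subset_of_isClosed_opDom {L : Submodule ℝ (X × (X →L[ℝ] ℝ))}
    (hcl : IsClosed (opDom (L : Set (X × (X →L[ℝ] ℝ)))))
    (h0 : ∀ u : X →L[ℝ] ℝ, (∀ x ∈ opDom (L : Set (X × (X →L[ℝ] ℝ))), u x = 0) →
      ((0 : X), u) ∈ L)
    {S : Set (X × (X →L[ℝ] ℝ))} (hS : IsMonotoneOp S) (hLS : (L : Set (X × (X →L[ℝ] ℝ))) ⊆ S) :
    S ⊆ L := by
  rintro ⟨x, xs⟩ hx
  have hdom : opDom (L : Set (X × (X →L[ℝ] ℝ))) =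
      (L.map (LinearMap.fst ℝ X (X →L[ℝ] ℝ)) : Set X) := by
    ext y
    simp [opDom]
  have hxd : x ∈ opDom (L : Set (X × (X →L[ℝ] ℝ))) := by
    by_contra hxn
    rw [hdom] at hcl hxn
    obtain ⟨f, c, hfc, hcx⟩ := geometric_hahn_banach_closed_point (Submodule.convex _) hcl hxn
    have hc : 0 < c := by simpa using hfc 0 (Submodule.zero_mem _)
    have hf : ∀ y ∈ opDom (L : Set (X × (X →L[ℝ] ℝ))), f y = 0 := fun y hy => by
      rw [hdom] at hy
      refine eq_zero_of_forall_add_mul_nonneg (a := c) fun t => ?_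
      have h1 := hfc _ (Submodule.smul_mem _ (-t) hy)
      simp only [map_smul, smul_eq_mul] at h1
      linarith
    have hfx : f x = 0 := by
      refine eq_zero_of_forall_add_mul_nonneg (a := xs x) fun t => ?_
      have h1 := hS _ hx _ (hLS (L.smul_mem (-t) (h0 f hf)))
      simpa using h1
    linarith
  obtain ⟨ys, hy⟩ := hxd
  have hmem := h0 (xs - ys) fun z hz => by
    obtain ⟨zs, hz⟩ := hz
    have hb : (ys - xs) z = 0 := by
      refine eq_zero_of_forall_mul_add_sq_mul_nonneg (a := zs z) fun t => ?_
      have h1 := hS _ (hLS (L.add_mem hy (L.smul_mem t hz))) _ hx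
      simp at h1 ⊢
      linarith
    simp only [sub_apply] at hb ⊢
    linarith
  simpa using L.add_mem hy hmem

/-- For a linear operator `T`: (1) if `T` is maximal `p`-monotone then
`T(0) = dom(T)^⊥`; (2) if `T` is `p`-monotone with norm-closed domain and `T(0) = dom(T)^⊥`,
then `T` is maximal monotone (= maximal 1-monotone) and maximal `p`-monotone. -/
theorem linear_maxPMonotone_zero_characterization [CompleteSpace X] (p : ℕ) (hp : 1 ≤ p)
    (T : Set (X × (X →L[ℝ] ℝ)))
    (hlin : ∃ L : Submodule ℝ (X × (X →L[ℝ] ℝ)), T = ↑L) :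
    (IsMaxPMonotone p T →
      {xs : X →L[ℝ] ℝ | ((0 : X), xs) ∈ T} =
        {xs : X →L[ℝ] ℝ | ∀ x ∈ opDom T, xs x = 0}) ∧
    (IsPMonotone p T → IsClosed (opDom T) →
      {xs : X →L[ℝ] ℝ | ((0 : X), xs) ∈ T} =
        {xs : X →L[ℝ] ℝ | ∀ x ∈ opDom T, xs x = 0} →
      IsMaxPMonotone 1 T ∧ IsMaxPMonotone p T) := by
  obtain ⟨L, rfl⟩ := hlin
  refine ⟨fun hT => ?_, fun hT hcl h0 => ?_⟩
  · ext u
    refine ⟨fun hu x hx => (hT.1.isMonotoneOp hp).apply_eq_zero hu hx, fun hu => ?_⟩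
    have hS := hT.2 _ hT.1.add_annihilator fun z hz => ⟨z.2, 0, hz, by simp, by simp⟩
    have hmem : ((0 : X), u) ∈ {z : X × (X →L[ℝ] ℝ) | ∃ v u : X →L[ℝ] ℝ,
        (z.1, v) ∈ (L : Set (X × (X →L[ℝ] ℝ))) ∧
        (∀ x ∈ opDom (L : Set (X × (X →L[ℝ] ℝ))), u x = 0) ∧ z.2 = v + u} :=
      ⟨0, u, L.zero_mem, hu, by simp⟩
    rw [hS] at hmem
    exact hmem
  · have hmax : ∀ S, IsMonotoneOp S → (L : Set (X × (X →L[ℝ] ℝ))) ⊆ S → S = L := fun S hS hLS =>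
      (hS.subset_of_isClosed_opDom hcl (fun u hu => h0.ge hu) hLS).antisymm hLS
    exact ⟨⟨(hT.isMonotoneOp hp).isPMonotone_one,
        fun S hS hLS => hmax S (hS.isMonotoneOp le_rfl) hLS⟩,
      ⟨hT, fun S hS hLS => hmax S (hS.isMonotoneOp hp) hLS⟩⟩
end
end

section
/- Let X be a real Banach space, T : X ⇉ X* a linear monotone multivalued operator, and S : X ⇉ X* a linear multivalued operator with T ⊂ S ⊂ T^{μ}. Then S is monotone. -/
open scoped BigOperators

noncomputable section

variable {X : Type*} [NormedAddCommGroup X] [NormedSpace ℝ X]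

/-- If `T` is linear monotone, `S` is linear and `T ⊆ S ⊆ T^{μ}`, then `S` is
monotone. -/
theorem linear_between_monotone [CompleteSpace X]
    (T S : Set (X × (X →L[ℝ] ℝ)))
    (hTlin : ∃ L : Submodule ℝ (X × (X →L[ℝ] ℝ)), T = ↑L)
    (hTmono : IsMonotoneOp T)
    (hSlin : ∃ L : Submodule ℝ (X × (X →L[ℝ] ℝ)), S = ↑L)
    (hTS : T ⊆ S) (hSpol : S ⊆ monoPolar T) :
    IsMonotoneOp S := by
  obtain ⟨L, rfl⟩ := hTlin
  obtain ⟨M, rfl⟩ := hSlin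
  intro a ha b hb
  simpa using hSpol (M.sub_mem ha hb) 0 L.zero_mem
end
end

section
/- Let X be a real Banach space, p ≥ 1 an integer, and T : X ⇉ X* a multivalued operator. If T_{p+} is monotone or T_{p−} is monotone (as operators from X^{p+1} to (X*)^{p+1} with the product duality pairing), then T is p-monotone. -/
open scoped BigOperators

noncomputable section

variable {X : Type*} [NormedAddCommGroup X] [NormedSpace ℝ X]

/-- The cyclic sum of `a` is the negative of the pairing of `i ↦ x_i - c` with
`i ↦ x_i* - x_{i-1}*`, for any base point `c`. -/
theorem sum_sub_pred_apply_eq_neg_cyclicSum (p : ℕ) (a : Fin (p + 1) → X × (X →L[ℝ] ℝ)) (c : X) :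
    ∑ i, ((a i).2 - (a (i - 1)).2) ((a i).1 - c) = -cyclicSum p a := by
  have hshift : ∑ i, (a (i - 1)).2 ((a i).1 - c) = ∑ i, (a i).2 ((a (i + 1)).1 - c) :=
    (Equiv.sum_comp (Equiv.addRight (1 : Fin (p + 1)))
      fun i => (a (i - 1)).2 ((a i).1 - c)).symm.trans (by simp)
  simp only [sub_apply, Finset.sum_sub_distrib, hshift, cyclicSum]
  rw [← Finset.sum_sub_distrib, ← Finset.sum_neg_distrib]
  refine Finset.sum_congr rfl fun i _ => ?_
  simp only [map_sub]
  ring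

/-- Reversing the cyclic order turns `T_{p+}` into `T_{p−}`. -/
theorem neg_mem_TpPlus_of_mem_TpMinus {p : ℕ} {T : Set (X × (X →L[ℝ] ℝ))}
    {z : (Fin (p + 1) → X) × (Fin (p + 1) → (X →L[ℝ] ℝ))} (hz : z ∈ TpMinus p T) :
    (fun i => z.1 (-i), fun i => z.2 (-i)) ∈ TpPlus p T := by
  intro i
  obtain ⟨u, v, hu, hv, huv⟩ := hz (-i)
  refine ⟨u, v, hu, ?_, huv⟩
  rwa [← neg_add'] at hv

theorem IsMonotoneBig.tpMinus_of_tpPlus {p : ℕ} {T : Set (X × (X →L[ℝ] ℝ))}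
    (h : IsMonotoneBig p (TpPlus p T)) : IsMonotoneBig p (TpMinus p T) := fun a ha b hb =>
  (h _ (neg_mem_TpPlus_of_mem_TpMinus ha) _ (neg_mem_TpPlus_of_mem_TpMinus hb)).trans_eq
    (Equiv.sum_comp (Equiv.neg (Fin (p + 1))) fun i => (a.2 i - b.2 i) (a.1 i - b.1 i))

theorem IsMonotoneBig.isPMonotone_of_tpMinus {p : ℕ} {T : Set (X × (X →L[ℝ] ℝ))}
    (h : IsMonotoneBig p (TpMinus p T)) : IsPMonotone p T := by
  intro a ha
  have key := h (fun i => (a i).1, fun i => (a i).2 - (a (i - 1)).2)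
    (fun i => ⟨_, _, ha i, ha (i - 1), rfl⟩)
    (fun _ => (a 0).1, fun _ => 0)
    (fun _ => ⟨_, _, ha 0, ha 0, (sub_self _).symm⟩)
  simp only [sub_zero, sum_sub_pred_apply_eq_neg_cyclicSum] at key
  linarith

/-- If `T_{p+}` or `T_{p−}` is monotone, then `T` is `p`-monotone. -/
theorem pMonotone_of_TpPlus_or_TpMinus_monotone [CompleteSpace X] (p : ℕ) (hp : 1 ≤ p)
    (T : Set (X × (X →L[ℝ] ℝ)))
    (h : IsMonotoneBig p (TpPlus p T) ∨ IsMonotoneBig p (TpMinus p T)) :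
    IsPMonotone p T := by
  exact (h.elim IsMonotoneBig.tpMinus_of_tpPlus id).isPMonotone_of_tpMinus
end
end

section
/- Let X be a real Banach space, p ≥ 1 an integer, and T : X ⇉ X* a linear multivalued operator. If T is p-monotone, then both T_{p+} and T_{p−} are monotone operators from X^{p+1} to (X*)^{p+1}. -/
open scoped BigOperators

noncomputable section

variable {X : Type*} [NormedAddCommGroup X] [NormedSpace ℝ X]

/-- A sum over `Fin (p + 1)` is invariant under the cyclic shift of the index. -/
theorem sum_comp_add_one {p : ℕ} (f : Fin (p + 1) → ℝ) : ∑ i, f (i + 1) = ∑ i, f i :=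
  Equiv.sum_comp (Equiv.addRight 1) f

/-- The values of a linear `p`-monotone operator at `0` annihilate its domain. -/
theorem IsPMonotone.apply_eq_zero {p : ℕ} (hp : 1 ≤ p)
    {L : Submodule ℝ (X × (X →L[ℝ] ℝ))} (hT : IsPMonotone p (L : Set (X × (X →L[ℝ] ℝ))))
    {x : X} {w n : X →L[ℝ] ℝ} (hx : (x, w) ∈ L) (hn : (0, n) ∈ L) : n x = 0 := by
  have h10 : (1 : Fin (p + 1)) ≠ 0 := by
    obtain ⟨q, rfl⟩ := Nat.exists_eq_add_of_le' hp
    exact one_ne_zero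
  have key : ∀ c : ℝ, c * n x ≤ w x := by
    intro c
    have hcn : ((0 : X), c • n) ∈ L := by simpa using L.smul_mem c hn
    have h := hT (fun i => if i = 0 then (0, c • n) else (x, w)) (fun i => by
      split_ifs
      exacts [hcn, hx])
    have hsum : cyclicSum p (fun i => if i = 0 then ((0 : X), c • n) else (x, w)) =
        ∑ i : Fin (p + 1), (if i = 0 then c * n x else 0) -
          ∑ i : Fin (p + 1), (if i + 1 = 0 then w x else 0) := by
      rw [cyclicSum, ← Finset.sum_sub_distrib]
      refine Finset.sum_congr rfl fun i _ => ?_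
      by_cases hi : i = 0
      · subst hi
        simp [h10]
      · by_cases hi' : i + 1 = 0 <;> simp [hi, hi']
    rw [hsum, sum_comp_add_one (fun i => if i = 0 then w x else 0)] at h
    simpa using h
  by_contra hne
  have h := key ((w x + 1) / n x)
  rw [div_mul_cancel₀ _ hne] at h
  linarith

/-- `T_{p−}` is monotone for a linear `p`-monotone operator. -/
theorem IsPMonotone.isMonotoneBig_TpMinus {p : ℕ} (hp : 1 ≤ p)
    {L : Submodule ℝ (X × (X →L[ℝ] ℝ))} (hT : IsPMonotone p (L : Set (X × (X →L[ℝ] ℝ)))) :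
    IsMonotoneBig p (TpMinus p (L : Set (X × (X →L[ℝ] ℝ)))) := by
  rintro a ha b hb
  choose u v hu hv huv using ha
  choose u' v' hu' hv' huv' using hb
  set x := fun i => a.1 i - b.1 i with hx
  set U := fun i => u i - u' i with hU
  set V := fun i => v i - v' i with hV
  have hxU : ∀ i, (x i, U i) ∈ L := fun i => L.sub_mem (hu i) (hu' i)
  have hxV : ∀ i, (x i, V (i + 1)) ∈ L := fun i => by
    simpa [hx, hV] using L.sub_mem (hv (i + 1)) (hv' (i + 1))
  have hUV : ∀ i, U i (x i) = V (i + 1) (x i) := fun i => by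
    have h := hT.apply_eq_zero hp (n := U i - V (i + 1)) (hxU i)
      (by simpa using L.sub_mem (hxU i) (hxV i))
    simpa [sub_eq_zero] using h
  have h := hT (fun i => (x i, V (i + 1))) hxV
  simp only [cyclicSum, map_sub, Finset.sum_sub_distrib] at h
  rw [sum_comp_add_one (fun i => V i (x i))] at h
  have hgoal : ∑ i, (a.2 i - b.2 i) (a.1 i - b.1 i) =
      ∑ i, V (i + 1) (x i) - ∑ i, V i (x i) := by
    rw [← Finset.sum_sub_distrib]
    refine Finset.sum_congr rfl fun i _ => ?_
    rw [← hUV, huv, huv', ← sub_apply, hU, hV, sub_sub_sub_comm]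
  rw [hgoal]
  linarith

/-- Reversing the cyclic order of the indices maps `T_{p+}` into `T_{p−}`. -/
theorem comp_neg_mem_TpMinus {p : ℕ} {T : Set (X × (X →L[ℝ] ℝ))}
    {z : (Fin (p + 1) → X) × (Fin (p + 1) → (X →L[ℝ] ℝ))} (hz : z ∈ TpPlus p T) :
    ((fun i => z.1 (-i), fun i => z.2 (-i)) :
      (Fin (p + 1) → X) × (Fin (p + 1) → (X →L[ℝ] ℝ))) ∈ TpMinus p T := by
  intro i
  obtain ⟨u, v, hu, hv, huv⟩ := hz (-i)
  exact ⟨u, v, hu, by simpa [neg_sub, sub_eq_neg_add, add_comm] using hv, huv⟩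

/-- If `T` is linear and `p`-monotone, then `T_{p+}` and `T_{p−}` are monotone. -/
theorem TpPlus_TpMinus_monotone_of_linear_pMonotone [CompleteSpace X] (p : ℕ) (hp : 1 ≤ p)
    (T : Set (X × (X →L[ℝ] ℝ)))
    (hlin : ∃ L : Submodule ℝ (X × (X →L[ℝ] ℝ)), T = ↑L)
    (hT : IsPMonotone p T) :
    IsMonotoneBig p (TpPlus p T) ∧ IsMonotoneBig p (TpMinus p T) := by
  obtain ⟨L, rfl⟩ := hlin
  have hminus := hT.isMonotoneBig_TpMinus hp
  refine ⟨fun a ha b hb => ?_, hminus⟩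
  have h := hminus _ (comp_neg_mem_TpMinus ha) _ (comp_neg_mem_TpMinus hb)
  exact h.trans_eq (Equiv.sum_comp (Equiv.neg (Fin (p + 1)))
    (fun i => (a.2 i - b.2 i) (a.1 i - b.1 i)))
end
end

section
/- Let X be a real Banach space, p ≥ 1 an integer, and T : X ⇉ X* a multivalued operator. Then (T*)_{p+} ⊂ (T_{p−})* and (T*)_{p−} ⊂ (T_{p+})*, where the adjoints of T_{p±} are taken with respect to the product duality pairing on X^{p+1} × (X*)^{p+1}. -/
open scoped BigOperators

noncomputable section

variable {X : Type*} [NormedAddCommGroup X] [NormedSpace ℝ X]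

/-- If `z i = u i - v i` and `w i = a i - b i`, where `(x i, u i)` and `(x (σ i), v i)` lie in the
adjoint of `T` while `(y i, a i)` and `(y (σ⁻¹ i), b i)` lie in `T`, then the pairing of `x` with `w`
equals the pairing of `y` with `z`. -/
lemma sum_pairing_eq_of_mem_adjointOp {ι : Type*} [Fintype ι] (σ : Equiv.Perm ι)
    {T : Set (X × (X →L[ℝ] ℝ))} {x y : ι → X} {z w : ι → (X →L[ℝ] ℝ)}
    (hz : ∀ i, ∃ u v, (x i, u) ∈ adjointOp T ∧ (x (σ i), v) ∈ adjointOp T ∧ z i = u - v)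
    (hw : ∀ i, ∃ a b, (y i, a) ∈ T ∧ (y (σ.symm i), b) ∈ T ∧ w i = a - b) :
    ∑ i, w i (x i) = ∑ i, z i (y i) := by
  choose u v hu hv hz using hz
  choose a b ha hb hw using hw
  have hau (i : ι) : a i (x i) = u i (y i) := hu i _ (ha i)
  have hbv (i : ι) : b (σ i) (x (σ i)) = v i (y i) := by
    have h := hb (σ i)
    rw [Equiv.symm_apply_apply] at h
    exact hv i _ h
  simp only [hz, hw, sub_apply, Finset.sum_sub_distrib, hau]
  rw [← Equiv.sum_comp σ fun i => b i (x i)]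
  simp only [hbv]

/-- `(T*)_{p+} ⊆ (T_{p−})*` and `(T*)_{p−} ⊆ (T_{p+})*`. -/
theorem adjoint_Tp_inclusions [CompleteSpace X] (p : ℕ) (hp : 1 ≤ p)
    (T : Set (X × (X →L[ℝ] ℝ))) :
    TpPlus p (adjointOp T) ⊆ adjointBig p (TpMinus p T) ∧
    TpMinus p (adjointOp T) ⊆ adjointBig p (TpPlus p T) := by
  constructor
  · intro z hz w hw
    exact sum_pairing_eq_of_mem_adjointOp (Equiv.addRight 1) hz
      (by simpa [TpMinus, sub_eq_add_neg] using hw)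
  · intro z hz w hw
    exact sum_pairing_eq_of_mem_adjointOp (Equiv.addRight 1).symm
      (by simpa [TpMinus, sub_eq_add_neg] using hz) hw
end
end
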